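/- There is no tile assembly system in the abstract Tile Assembly Model that strictly self-assembles the U fractal 𝐔. That is, for every aTAM tile assembly system 𝒯 = (T, σ, τ), it is not the case that every producible terminal assembly of 𝒯 has domain exactly 𝐔. -/

import Mathlib

/-- A point of the integer lattice `ℤ²`. -/
abbrev Pt := ℤ × ℤ

/-- The generator of the U fractal. -/
def GU : Set Pt := {(0,0),(0,1),(0,2),(1,0),(2,0),(2,1),(2,2)}

/-- `scaleAddU k A B = A + k·B` (componentwise). -/
def scaleAddU (k : ℤ) (A B : Set Pt) : Set Pt :=
  {q | ∃ p ∈ A, ∃ g ∈ B, q = (p.1 + k * g.1, p.2 + k * g.2)}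

/-- The stages of the U fractal: `ustage 1 = GU` and
`ustage (i+1) = ustage i + 3^i · GU` for `i ≥ 1`. -/
def ustage : ℕ → Set Pt
  | 0 => ∅
  | 1 => GU
  | n + 2 => scaleAddU (3 ^ (n + 1)) (ustage (n + 1)) GU

/-- The U fractal `𝐔 = ⋃_{i ≥ 1} u_i`. -/
def UFractal : Set Pt := {p | ∃ i : ℕ, 1 ≤ i ∧ p ∈ ustage i}

/-- A tile type: a glue (label, drawn from `ℕ`) on each of its four sides.
The strength of a glue label is given by a strength function. -/
structure TileType where
  north : ℕ
  east : ℕ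
  south : ℕ
  west : ℕ
deriving DecidableEq

/-- An assembly: a partial function from `ℤ²` to tile types. -/
abbrev Assembly := Pt → Option TileType

/-- The domain of an assembly. -/
def adom (α : Assembly) : Set Pt := {p | α p ≠ none}

/-- The strength of the bond between the tiles of `α` at positions `p` and `q`
(zero unless `q` is adjacent to `p`, both are tiled, and the abutting glues match). -/
def bond (s : ℕ → ℕ) (α : Assembly) (p q : Pt) : ℕ :=
  match α p, α q with
  | some t, some t' =>
      if q = (p.1 + 1, p.2) then (if t.east = t'.west then s t.east else 0)
      else if q = (p.1 - 1, p.2) then (if t.west = t'.east then s t.west else 0)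
      else if q = (p.1, p.2 + 1) then (if t.north = t'.south then s t.north else 0)
      else if q = (p.1, p.2 - 1) then (if t.south = t'.north then s t.south else 0)
      else 0
  | _, _ => 0

/-- `α` is `τ`-stable: every cut of its binding graph has total glue strength at
least `τ` (witnessed by finitely many bonds crossing the cut). -/
def IsStable (s : ℕ → ℕ) (τ : ℕ) (α : Assembly) : Prop :=
  ∀ A B : Set Pt, A ∪ B = adom α → Disjoint A B → A.Nonempty → B.Nonempty →
    ∃ F : Finset (Pt × Pt), (∀ e ∈ F, e.1 ∈ A ∧ e.2 ∈ B) ∧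
      τ ≤ ∑ e ∈ F, bond s α e.1 e.2

/-- The total strength with which a tile of type `t` placed at the empty position `p`
would bind to its already-placed neighbors in `α`. -/
def attachStrength (s : ℕ → ℕ) (α : Assembly) (p : Pt) (t : TileType) : ℕ :=
  (match α (p.1 + 1, p.2) with
    | some t' => if t.east = t'.west then s t.east else 0
    | none => 0) +
  (match α (p.1 - 1, p.2) with
    | some t' => if t.west = t'.east then s t.west else 0
    | none => 0) +
  (match α (p.1, p.2 + 1) with
    | some t' => if t.north = t'.south then s t.north else 0
    | none => 0) +
  (match α (p.1, p.2 - 1) with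
    | some t' => if t.south = t'.north then s t.south else 0
    | none => 0)

/-- An aTAM tile assembly system `𝒯 = (T, σ, τ)`: a glue strength function, a finite
tile set, a finite `τ`-stable seed assembly, and a temperature `τ`. -/
structure TAS where
  strength : ℕ → ℕ
  tiles : Finset TileType
  seed : Assembly
  temp : ℕ
  seed_finite : (adom seed).Finite
  seed_tiles : ∀ p t, seed p = some t → t ∈ tiles
  seed_stable : IsStable strength temp seed

/-- A single-tile attachment step: a tile of the system attaches at an empty
position with total binding strength at least the temperature. -/
def Step (S : TAS) (α β : Assembly) : Prop :=
  ∃ p t, t ∈ S.tiles ∧ α p = none ∧ S.temp ≤ attachStrength S.strength α p t ∧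
    β = Function.update α p (some t)

/-- `β` is the result of a (finite or infinite) sequence of single-tile attachment
steps starting from `α`. -/
def ReachesFrom (S : TAS) (α β : Assembly) : Prop :=
  ∃ c : ℕ → Assembly, c 0 = α ∧ (∀ n, c (n + 1) = c n ∨ Step S (c n) (c (n + 1))) ∧
    (∀ p n t, c n p = some t → β p = some t) ∧
    (∀ p t, β p = some t → ∃ n, c n p = some t)

/-- A producible assembly: the result of a (finite or infinite) sequence of
single-tile attachment steps starting from the seed. -/
def Producible (S : TAS) (α : Assembly) : Prop := ReachesFrom S S.seed α

/-- A terminal assembly: no tile can attach to it. -/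
def Terminal (S : TAS) (α : Assembly) : Prop := ∀ β, ¬ Step S α β

/-- `S` finitely self-assembles `X` if every finite producible assembly of `S` can be
extended, by a (finite or infinite) sequence of single-tile attachment steps, to an
assembly whose domain is exactly `X`. -/
def FinitelySelfAssembles (S : TAS) (X : Set Pt) : Prop :=
  ∀ α, Producible S α → (adom α).Finite →
    ∃ β, ReachesFrom S α β ∧ adom β = X

/-- `S` strictly self-assembles `X` if every producible terminal assembly of `S`
has domain exactly `X`. -/
def StrictlySelfAssembles (S : TAS) (X : Set Pt) : Prop :=
  ∀ α, Producible S α → Terminal S α → adom α = X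

/-! ## Geometry of the U fractal -/

lemma ustage_prop (n : ℕ) : ∀ p ∈ ustage (n + 1), 0 ≤ p.1 ∧ p.1 < 3 ^ (n + 1) ∧ 0 ≤ p.2 ∧
    p.2 < 3 ^ (n + 1) ∧ ∀ i : ℕ, (p.1 / 3 ^ i) % 3 = 1 → (p.2 / 3 ^ i) % 3 = 0 := by
  have GUp : ∀ g ∈ GU, 0 ≤ g.1 ∧ g.1 < 3 ∧ 0 ≤ g.2 ∧ g.2 < 3 ∧ (g.1 = 1 → g.2 = 0) := by
    intro g hg
    simp only [GU, Set.mem_insert_iff, Set.mem_singleton_iff] at hg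
    rcases hg with h | h | h | h | h | h | h <;> subst h <;> simp
  -- digits of `r + 3^n * g`
  have digit : ∀ (n i : ℕ) (r g : ℤ), 0 ≤ r → r < 3 ^ n → 0 ≤ g → g < 3 →
      ((r + 3 ^ n * g) / 3 ^ i) % 3 = if i < n then (r / 3 ^ i) % 3 else if i = n then g else 0 := by
    intro n i r g h0 h1 h2 h3
    split_ifs with c1 c2
    · obtain ⟨d, rfl⟩ := Nat.exists_eq_add_of_lt c1
      have : r + 3 ^ (i + d + 1) * g = r + 3 ^ i * (3 * (3 ^ d * g)) := by ring
      rw [this, Int.add_mul_ediv_left _ _ (by positivity)]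
      omega
    · subst c2
      rw [Int.add_mul_ediv_left _ _ (by positivity), Int.ediv_eq_zero_of_lt h0 h1]
      omega
    · have hlt : n + 1 ≤ i := by omega
      have : (3:ℤ) ^ (n + 1) ≤ 3 ^ i := pow_le_pow_right₀ (by norm_num) hlt
      have hg : (3:ℤ) ^ n * g ≤ 3 ^ n * 2 := by
        apply mul_le_mul_of_nonneg_left (by omega) (by positivity)
      rw [Int.ediv_eq_zero_of_lt (by positivity)]
      · rfl
      · rw [pow_succ] at this; linarith
  induction n with
  | zero =>
    intro p hp
    obtain ⟨a1, a2, a3, a4, a5⟩ := GUp p hp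
    refine ⟨a1, by simpa using a2, a3, by simpa using a4, ?_⟩
    intro i
    have h1 := digit 0 i 0 p.1 le_rfl (by simp) a1 a2
    have h2 := digit 0 i 0 p.2 le_rfl (by simp) a3 a4
    simp only [pow_zero, one_mul, zero_add] at h1 h2
    rw [h1, h2]
    split_ifs <;> simp_all
  | succ n ih =>
    rintro q ⟨p, hp, g, hg, rfl⟩
    obtain ⟨a1, a2, a3, a4, a5⟩ := GUp g hg
    obtain ⟨b1, b2, b3, b4, b5⟩ := ih p hp
    have e1 : (3:ℤ) ^ (n + 1) * g.1 ≤ 3 ^ (n + 1) * 2 :=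
      mul_le_mul_of_nonneg_left (by omega) (by positivity)
    have e2 : (3:ℤ) ^ (n + 1) * g.2 ≤ 3 ^ (n + 1) * 2 :=
      mul_le_mul_of_nonneg_left (by omega) (by positivity)
    have e3 : (3:ℤ) ^ (n + 1 + 1) = 3 ^ (n + 1) * 3 := pow_succ _ _
    refine ⟨by positivity, by simp only; linarith, by positivity, by simp only; linarith, ?_⟩
    intro i
    simp only
    rw [digit _ _ _ _ b1 b2 a1 a2, digit _ _ _ _ b3 b4 a3 a4]
    split_ifs
    · exact b5 i
    · exact a5
    · simp

lemma U_prop {x y : ℤ} (h : (x, y) ∈ UFractal) : 0 ≤ x ∧ 0 ≤ y ∧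
    ∀ i : ℕ, (x / 3 ^ i) % 3 = 1 → (y / 3 ^ i) % 3 = 0 := by
  obtain ⟨i, hi, h⟩ := h
  obtain ⟨n, rfl⟩ := Nat.exists_eq_add_of_le' hi
  obtain ⟨a, _, b, _, c⟩ := ustage_prop n _ h
  exact ⟨a, b, c⟩

lemma corner_mem (n : ℕ) : ((3:ℤ) ^ (n + 1) - 1, (3:ℤ) ^ (n + 1) - 1) ∈ ustage (n + 1) := by
  induction n with
  | zero => simp [ustage, GU]
  | succ n ih =>
    refine ⟨_, ih, (2, 2), by simp [GU], ?_⟩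
    ext <;> simp only <;> ring

/-- The abscissa `11…1` (in base 3, `m` digits). -/
def cc : ℕ → ℤ
  | 0 => 0
  | m + 1 => cc m + 3 ^ m

lemma cc_two (m : ℕ) : 2 * cc m + 1 = 3 ^ m := by
  induction m with
  | zero => simp [cc]
  | succ m ih => rw [cc, pow_succ]; linarith

lemma cc_nonneg (m : ℕ) : 0 ≤ cc m := by
  have := cc_two m
  have : (0:ℤ) < 3 ^ m := by positivity
  omega

lemma cc_split (i d : ℕ) : ∃ e, cc (i + d + 1) = cc i + 3 ^ i * (1 + 3 * e) := by
  induction d with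
  | zero => exact ⟨0, by simp [cc]⟩
  | succ d ih =>
    obtain ⟨e, he⟩ := ih
    refine ⟨e + 3 ^ d, ?_⟩
    have : i + (d + 1) + 1 = (i + d + 1) + 1 := by ring
    rw [this, cc, he]
    ring

lemma digit_one {i : ℕ} {r e : ℤ} (h0 : 0 ≤ r) (h1 : r < 3 ^ i) :
    ((r + 3 ^ i * (1 + 3 * e)) / 3 ^ i) % 3 = 1 := by
  rw [Int.add_mul_ediv_left _ _ (by positivity), Int.ediv_eq_zero_of_lt h0 h1]
  omega

lemma dvd_step {i : ℕ} {y : ℤ} (h : (3:ℤ) ^ i ∣ y) (h2 : (y / 3 ^ i) % 3 = 0) :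
    (3:ℤ) ^ (i + 1) ∣ y := by
  obtain ⟨k, rfl⟩ := h
  rw [Int.mul_ediv_cancel_left _ (by positivity)] at h2
  rw [pow_succ]
  exact mul_dvd_mul_left _ (Int.dvd_of_emod_eq_zero h2)

lemma geo_cut {m : ℕ} {y : ℤ} (h : (cc m, y) ∈ UFractal) : (3:ℤ) ^ m ∣ y := by
  obtain ⟨-, -, h⟩ := U_prop h
  suffices ∀ i, i ≤ m → (3:ℤ) ^ i ∣ y from this m le_rfl
  intro i
  induction i with
  | zero => simp
  | succ i ih =>
    intro hi
    apply dvd_step (ih (by omega))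
    apply h
    obtain ⟨d, rfl⟩ := Nat.exists_eq_add_of_lt (show i < m by omega)
    obtain ⟨e, he⟩ := cc_split i d
    rw [he]
    have := cc_two i
    have := cc_nonneg i
    exact digit_one (by omega) (by omega)

lemma geo_return {m m' N : ℕ} {y b : ℤ} (hm : m < m') (hN : N ≤ m') (hy : (3:ℤ) ^ m' ∣ y)
    (hb : (3:ℤ) ^ (m + 1) ∣ b) (b0 : 0 ≤ b) (bN : b < 3 ^ N)
    (h : (cc m' + 3 ^ m, y + b) ∈ UFractal) : b = 0 := by
  obtain ⟨-, -, h⟩ := U_prop h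
  have key : ∀ i, m + 1 ≤ i → i ≤ m' → (3:ℤ) ^ i ∣ y + b := by
    intro i hi
    induction i, hi using Nat.le_induction with
    | base =>
      intro _
      exact dvd_add ((pow_dvd_pow 3 (by omega)).trans hy) hb
    | succ i hi ih =>
      intro hi2
      apply dvd_step (ih (by omega))
      apply h
      obtain ⟨d, rfl⟩ := Nat.exists_eq_add_of_lt (show i < m' by omega)
      obtain ⟨e, he⟩ := cc_split i d
      have h1 := cc_two i
      have h2 := cc_nonneg i
      have h3 : (3:ℤ) ^ (m + 1) ≤ 3 ^ i := pow_le_pow_right₀ (by norm_num) hi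
      have h4 : (0:ℤ) < 3 ^ m := by positivity
      rw [pow_succ] at h3
      have : cc (i + d + 1) + 3 ^ m = (cc i + 3 ^ m) + 3 ^ i * (1 + 3 * e) := by rw [he]; ring
      rw [this]
      exact digit_one (by omega) (by omega)
  have h1 : (3:ℤ) ^ m' ∣ b := (dvd_add_right hy).1 (key m' (by omega) le_rfl)
  have h2 : (3:ℤ) ^ N ≤ 3 ^ m' := pow_le_pow_right₀ (by norm_num) hN
  exact Int.eq_zero_of_dvd_of_nonneg_of_lt b0 (by omega) h1

lemma geo_vert {m m' : ℕ} {y y' a b b' : ℤ} (hm : m < m') (hy : (3:ℤ) ^ m ∣ y)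
    (hy' : (3:ℤ) ^ m' ∣ y') (a0 : 0 ≤ a) (am : a < 3 ^ m) (b0 : 0 ≤ b) (bm : b < 3 ^ m)
    (hb : b' = b + 1 ∨ b' = b - 1)
    (h1 : (cc m + 1 + a, y + b) ∈ UFractal) (h2 : (cc m + 1 + a, y + b') ∈ UFractal)
    (h3 : (cc m' + 1 + a, y' + b') ∈ UFractal) : 0 ≤ b' ∧ b' < 3 ^ m := by
  by_contra hcon
  have hb' : b' = 3 ^ m ∨ b' = -1 := by omega
  have hpos : (0:ℤ) < 3 ^ m := by positivity
  have h2c := cc_two m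
  have h0c := cc_nonneg m
  have dig : ∀ k : ℤ, (3 ^ m * k + b') / 3 ^ m = k + 1 ∨ (3 ^ m * k + b') / 3 ^ m = k - 1 := by
    intro k
    rcases hb' with h | h
    · left
      rw [h, show (3:ℤ) ^ m * k + 3 ^ m = 3 ^ m * (k + 1) by ring,
        Int.mul_ediv_cancel_left _ (by positivity)]
    · right
      rw [h, show (3:ℤ) ^ m * k + -1 = (3 ^ m - 1) + 3 ^ m * (k - 1) by ring,
        Int.add_mul_ediv_left _ _ (by positivity), Int.ediv_eq_zero_of_lt (by omega) (by omega)]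
      ring
  by_cases ha : a < cc m
  · obtain ⟨-, -, h3⟩ := U_prop h3
    obtain ⟨d, rfl⟩ := Nat.exists_eq_add_of_lt hm
    obtain ⟨e, he⟩ := cc_split m d
    obtain ⟨k, rfl⟩ := hy'
    have := h3 m (by
      rw [he, show cc m + 3 ^ m * (1 + 3 * e) + 1 + a = (cc m + 1 + a) + 3 ^ m * (1 + 3 * e) by ring]
      exact digit_one (by omega) (by omega))
    rw [show (3:ℤ) ^ (m + d + 1) * k = 3 ^ m * (3 * (3 ^ d * k)) by ring] at this
    rcases dig (3 * (3 ^ d * k)) with h | h <;> rw [h] at this <;> omega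
  · obtain ⟨-, -, h1⟩ := U_prop h1
    obtain ⟨-, -, h2⟩ := U_prop h2
    obtain ⟨k, rfl⟩ := hy
    have hd : ((cc m + 1 + a) / 3 ^ m) % 3 = 1 := by
      rw [show cc m + 1 + a = (a - cc m) + 3 ^ m * (1 + 3 * 0) by rw [← h2c]; ring]
      exact digit_one (by omega) (by omega)
    have e1 := h1 m hd
    have e2 := h2 m hd
    rw [add_comm, Int.add_mul_ediv_left _ _ (by positivity), Int.ediv_eq_zero_of_lt b0 bm] at e1
    rcases dig k with h | h <;> rw [h] at e2 <;> omega

/-! ## Basic facts about attachment and growth -/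

lemma attach_mono {s : ℕ → ℕ} {γ β : Assembly} {p q : Pt} {t : TileType}
    (h1 : ∀ u, γ (p.1 + 1, p.2) = some u → β (q.1 + 1, q.2) = some u)
    (h2 : ∀ u, γ (p.1 - 1, p.2) = some u → β (q.1 - 1, q.2) = some u)
    (h3 : ∀ u, γ (p.1, p.2 + 1) = some u → β (q.1, q.2 + 1) = some u)
    (h4 : ∀ u, γ (p.1, p.2 - 1) = some u → β (q.1, q.2 - 1) = some u) :
    attachStrength s γ p t ≤ attachStrength s β q t := by
  unfold attachStrength
  refine add_le_add (add_le_add (add_le_add ?_ ?_) ?_) ?_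
  · rcases h : γ (p.1 + 1, p.2) with _ | u
    · simp
    · rw [h1 u h]
  · rcases h : γ (p.1 - 1, p.2) with _ | u
    · simp
    · rw [h2 u h]
  · rcases h : γ (p.1, p.2 + 1) with _ | u
    · simp
    · rw [h3 u h]
  · rcases h : γ (p.1, p.2 - 1) with _ | u
    · simp
    · rw [h4 u h]

lemma attach_pos {s : ℕ → ℕ} {α : Assembly} {p : Pt} {t : TileType}
    (h : 1 ≤ attachStrength s α p t) : α (p.1 + 1, p.2) ≠ none ∨ α (p.1 - 1, p.2) ≠ none ∨
      α (p.1, p.2 + 1) ≠ none ∨ α (p.1, p.2 - 1) ≠ none := by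
  by_contra hc
  push Not at hc
  obtain ⟨h1, h2, h3, h4⟩ := hc
  simp [attachStrength, h1, h2, h3, h4] at h

/-- Assemblies obtained from `σ` by finitely many attachments in the region `R`. -/
inductive Gen (S : TAS) (R : Set Pt) (σ : Assembly) : Assembly → Prop
  | base : Gen S R σ σ
  | step {α : Assembly} {p : Pt} {t : TileType} : Gen S R σ α → p ∈ R → t ∈ S.tiles →
      α p = none → S.temp ≤ attachStrength S.strength α p t →
      Gen S R σ (Function.update α p (some t))

/-- Finitely producible assemblies. -/
abbrev FinProd (S : TAS) : Assembly → Prop := Gen S Set.univ S.seed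

/-- The assembly with a single tile at the origin. -/
def single (t : TileType) : Assembly := Function.update (fun _ => none) (0, 0) (some t)

/-- Growth of a single tile in the right half-plane. -/
abbrev Grow (S : TAS) (t : TileType) : Assembly → Prop := Gen S {p | 0 ≤ p.1} (single t)

lemma reaches_cons {S : TAS} {α α' β : Assembly} (h : Step S α' α) (hr : ReachesFrom S α β) :
    ReachesFrom S α' β := by
  obtain ⟨c, c0, cs, cl, cr⟩ := hr
  have hle : ∀ p t, α' p = some t → α p = some t := by
    obtain ⟨q, u, -, hq, -, rfl⟩ := h
    intro p t hp
    by_cases hpq : p = q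
    · subst hpq; simp [hq] at hp
    · simpa [Function.update_of_ne hpq] using hp
  refine ⟨fun n => Nat.casesOn n α' c, rfl, ?_, ?_, ?_⟩
  · intro n
    cases n with
    | zero => right; simpa [c0] using h
    | succ n => exact cs n
  · intro p n t hp
    cases n with
    | zero => exact cl p 0 t (by rw [c0]; exact hle p t hp)
    | succ n => exact cl p n t hp
  · intro p t hp
    obtain ⟨n, hn⟩ := cr p t hp
    exact ⟨n + 1, hn⟩

lemma reaches_terminal (S : TAS) (α : Assembly) : ∃ β, ReachesFrom S α β ∧ Terminal S β := by
  classical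
  let sched : ℕ → Pt := fun n => (Denumerable.eqv Pt).symm n.unpair.1
  have hs : ∀ p n0, ∃ n, n0 ≤ n ∧ sched n = p := by
    intro p n0
    refine ⟨Nat.pair (Denumerable.eqv Pt p) n0, Nat.right_le_pair _ _, ?_⟩
    simp [sched]
  let can : Assembly → Pt → Prop := fun γ p =>
    γ p = none ∧ ∃ t, t ∈ S.tiles ∧ S.temp ≤ attachStrength S.strength γ p t
  have hnext : ∀ n γ, ∃ γ', (γ' = γ ∨ Step S γ γ') ∧ (can γ (sched n) → γ' (sched n) ≠ none) := by
    intro n γ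
    by_cases h : can γ (sched n)
    · obtain ⟨h0, t, h1, h2⟩ := h
      exact ⟨Function.update γ (sched n) (some t), Or.inr ⟨_, _, h1, h0, h2, rfl⟩, by simp⟩
    · exact ⟨γ, Or.inl rfl, fun hc => absurd hc h⟩
  choose next hnx1 hnx2 using hnext
  let c : ℕ → Assembly := fun n => Nat.rec α next n
  have cs : ∀ n, c (n + 1) = c n ∨ Step S (c n) (c (n + 1)) := fun n => hnx1 n (c n)
  have c1 : ∀ n p t, c n p = some t → c (n + 1) p = some t := by
    intro n p t hp
    rcases cs n with h | ⟨q, u, -, hq, -, h⟩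
    · rw [h]; exact hp
    · rw [h]
      by_cases hpq : p = q
      · subst hpq; simp [hq] at hp
      · simpa [Function.update_of_ne hpq] using hp
  have cm : ∀ n n', n ≤ n' → ∀ p t, c n p = some t → c n' p = some t := by
    intro n n' h
    induction n', h using Nat.le_induction with
    | base => intro p t h; exact h
    | succ k _ ih => intro p t h; exact c1 _ _ _ (ih p t h)
  have hβ : ∀ p, ∃ o : Option TileType, (∀ n t, c n p = some t → o = some t) ∧
      (∀ t, o = some t → ∃ n, c n p = some t) := by
    intro p
    rcases Classical.em (∃ n u, c n p = some u) with h | h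
    · obtain ⟨n, u, hu⟩ := h
      refine ⟨some u, fun n' t hp => ?_, fun t ht => ⟨n, by rw [hu, ht]⟩⟩
      have e1 := cm _ _ (le_max_left n n') p u hu
      have e2 := cm _ _ (le_max_right n n') p t hp
      rw [e1] at e2
      exact e2
    · exact ⟨none, fun n t hp => absurd ⟨n, t, hp⟩ h, fun t ht => by simp at ht⟩
  choose β b1 b2 using hβ
  refine ⟨β, ⟨c, rfl, cs, b1, b2⟩, ?_⟩
  rintro _ ⟨p, t, ht, hp, hst, -⟩
  have ev : ∀ q, ∃ n0, ∀ n, n0 ≤ n → ∀ u, β q = some u → c n q = some u := by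
    intro q
    rcases h : β q with _ | u
    · exact ⟨0, by simp⟩
    · obtain ⟨n0, h0⟩ := b2 q u h
      refine ⟨n0, fun n hn v hv => ?_⟩
      simp only [Option.some.injEq] at hv
      subst hv
      exact cm _ _ hn _ _ h0
  obtain ⟨n1, h1⟩ := ev (p.1 + 1, p.2)
  obtain ⟨n2, h2⟩ := ev (p.1 - 1, p.2)
  obtain ⟨n3, h3⟩ := ev (p.1, p.2 + 1)
  obtain ⟨n4, h4⟩ := ev (p.1, p.2 - 1)
  obtain ⟨n, hn, hsn⟩ := hs p (n1 + n2 + n3 + n4)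
  have hcn : ∀ k, c k p = none := by
    intro k
    rcases h : c k p with _ | u
    · rfl
    · rw [b1 p k u h] at hp; simp at hp
  have hcan : can (c n) (sched n) := by
    rw [hsn]
    exact ⟨hcn n, t, ht, hst.trans (attach_mono (h1 n (by omega)) (h2 n (by omega))
      (h3 n (by omega)) (h4 n (by omega)))⟩
  have := hcn (n + 1)
  rw [← hsn] at this
  exact hnx2 n (c n) hcan this

lemma finProd_reaches {S : TAS} {α : Assembly} (h : FinProd S α) :
    ∀ β, ReachesFrom S α β → Producible S β := by
  induction h with
  | base => exact fun β h => h
  | step hα hR ht hn hs ih =>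
    intro β hβ
    exact ih β (reaches_cons ⟨_, _, ht, hn, hs, rfl⟩ hβ)

lemma reaches_le {S : TAS} {α β : Assembly} (h : ReachesFrom S α β) {p : Pt} {t : TileType}
    (hp : α p = some t) : β p = some t := by
  obtain ⟨c, c0, -, cl, -⟩ := h
  exact cl p 0 t (by rw [c0]; exact hp)

lemma finProd_sub {S : TAS} {X : Set Pt} (hS : StrictlySelfAssembles S X) {α : Assembly}
    (h : FinProd S α) {p : Pt} (hp : α p ≠ none) : p ∈ X := by
  obtain ⟨β, hr, ht⟩ := reaches_terminal S α
  rw [← hS β (finProd_reaches h β hr) ht]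
  obtain ⟨u, hu⟩ := Option.ne_none_iff_exists'.1 hp
  change β p ≠ none
  simp [reaches_le hr hu]

lemma finProd_hits {S : TAS} {X : Set Pt} (hS : StrictlySelfAssembles S X) {p : Pt} (hp : p ∈ X) :
    ∃ α, FinProd S α ∧ α p ≠ none := by
  obtain ⟨β, hr, ht⟩ := reaches_terminal S S.seed
  rw [← hS β hr ht] at hp
  obtain ⟨u, hu⟩ := Option.ne_none_iff_exists'.1 hp
  obtain ⟨c, c0, cs, -, cr⟩ := hr
  obtain ⟨n, hn⟩ := cr p u hu
  refine ⟨c n, ?_, by simp [hn]⟩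
  clear hn
  induction n with
  | zero => rw [c0]; exact Gen.base
  | succ n ih =>
    rcases cs n with h | ⟨q, t, h1, h2, h3, h⟩
    · rw [h]; exact ih
    · rw [h]; exact Gen.step ih trivial h1 h2 h3

lemma finProd_tiles {S : TAS} {α : Assembly} (h : FinProd S α) :
    ∀ p t, α p = some t → t ∈ S.tiles := by
  induction h with
  | base => exact S.seed_tiles
  | @step α q u hα hR ht hn hs ih =>
    intro p t hp
    by_cases hpq : p = q
    · subst hpq
      simp only [Function.update_self, Option.some.injEq] at hp
      exact hp ▸ ht
    · rw [Function.update_of_ne hpq] at hp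
      exact ih p t hp

lemma temp_pos {S : TAS} (hS : StrictlySelfAssembles S UFractal) : 1 ≤ S.temp := by
  by_contra h
  obtain ⟨α, hα, hp⟩ := finProd_hits hS (p := (3 ^ (0 + 1) - 1, 3 ^ (0 + 1) - 1))
    ⟨1, le_rfl, corner_mem 0⟩
  obtain ⟨t, ht⟩ := Option.ne_none_iff_exists'.1 hp
  have hneg : ((-1 : ℤ), (0 : ℤ)) ∉ UFractal := fun hc => by
    have := (U_prop hc).1
    omega
  have hn : α (-1, 0) = none := by
    by_contra hc
    exact hneg (finProd_sub hS hα hc)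
  have := Gen.step hα (p := (-1, 0)) (t := t) trivial (finProd_tiles hα _ _ ht) hn (by omega)
  exact hneg (finProd_sub hS this (by simp))

lemma gen_supp {S : TAS} {R : Set Pt} {σ α : Assembly} (h : Gen S R σ α)
    (hσ : ∀ p, σ p ≠ none → p ∈ R) : ∀ p, α p ≠ none → p ∈ R := by
  induction h with
  | base => exact hσ
  | @step α q u hα hR ht hn hs ih =>
    intro p hp
    by_cases hpq : p = q
    · exact hpq ▸ hR
    · rw [Function.update_of_ne hpq] at hp
      exact ih p hp

lemma grow_supp {S : TAS} {t : TileType} {γ : Assembly} (h : Grow S t γ) {p : Pt}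
    (hp : γ p ≠ none) : 0 ≤ p.1 := by
  refine gen_supp h ?_ p hp
  intro q hq
  by_cases h0 : q = (0, 0)
  · subst h0; simp
  · simp [single, Function.update_of_ne h0] at hq

/-- `t` can be the first tile to the right of the cut of scale `m`, at height `y`. -/
def Cross (S : TAS) (m : ℕ) (y : ℤ) (t : TileType) : Prop :=
  ∃ α, FinProd S α ∧ (∀ p, α p ≠ none → p.1 ≤ cc m) ∧ t ∈ S.tiles ∧
    S.temp ≤ attachStrength S.strength α (cc m + 1, y) t

/-- Glue `γ`, moved to `(c+1, y)`, on the right of the assembly `α`. -/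
def overlay (α : Assembly) (c y : ℤ) (γ : Assembly) : Assembly :=
  fun p => if p.1 ≤ c then α p else γ (p.1 - (c + 1), p.2 - y)

lemma embed {S : TAS} {α γ : Assembly} {c y : ℤ} {t : TileType} (hα : FinProd S α)
    (hc : ∀ p, α p ≠ none → p.1 ≤ c) (ht : t ∈ S.tiles)
    (hs : S.temp ≤ attachStrength S.strength α (c + 1, y) t) (hγ : Grow S t γ) :
    FinProd S (overlay α c y γ) := by
  have hnone : ∀ p : Pt, c < p.1 → α p = none := by
    intro p hp
    by_contra h
    have := hc p h
    omega
  induction hγ with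
  | base =>
    have : overlay α c y (single t) = Function.update α (c + 1, y) (some t) := by
      funext p
      by_cases hp : p = (c + 1, y)
      · subst hp; simp [overlay, single]
      · rw [Function.update_of_ne hp]
        by_cases hpc : p.1 ≤ c
        · simp [overlay, hpc]
        · rw [hnone p (by omega)]
          simp only [overlay, if_neg hpc, single]
          rw [Function.update_of_ne]
          intro h
          apply hp
          simp only [Prod.mk.injEq] at h
          ext <;> simp only <;> omega
    rw [this]
    exact Gen.step hα trivial ht (hnone _ (by simp)) hs
  | @step γ p u hγ hR hu hn hst ih =>
    have hR : 0 ≤ p.1 := hR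
    have hov : ∀ a b : ℤ, ∀ v, γ (a, b) = some v → overlay α c y γ (a + (c + 1), b + y) = some v := by
      intro a b v hv
      have : 0 ≤ a := grow_supp hγ (p := (a, b)) (by simp [hv])
      simp only [overlay]
      rw [if_neg (by omega)]
      simpa using hv
    have : overlay α c y (Function.update γ p (some u)) =
        Function.update (overlay α c y γ) (p.1 + (c + 1), p.2 + y) (some u) := by
      funext q
      by_cases hq : q = (p.1 + (c + 1), p.2 + y)
      · subst hq
        simp only [overlay, Function.update_self]
        rw [if_neg (by omega)]
        simp
      · rw [Function.update_of_ne hq]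
        by_cases hqc : q.1 ≤ c
        · simp [overlay, hqc]
        · simp only [overlay, if_neg hqc]
          rw [Function.update_of_ne]
          intro h
          apply hq
          rw [← h]
          simp
    rw [this]
    refine Gen.step ih trivial hu ?_ (hst.trans (attach_mono ?_ ?_ ?_ ?_))
    · simp only [overlay]
      rw [if_neg (by omega)]
      simpa using hn
    · intro v hv
      rw [← hov _ _ v hv]
      congr 2 <;> ring
    · intro v hv
      rw [← hov _ _ v hv]
      congr 2 <;> ring
    · intro v hv
      rw [← hov _ _ v hv]
      congr 2 <;> ring
    · intro v hv
      rw [← hov _ _ v hv]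
      congr 2 <;> ring

lemma overlay_at {S : TAS} {t : TileType} {α γ : Assembly} {c y a b : ℤ} (hγ : Grow S t γ)
    {v : TileType} (hv : γ (a, b) = some v) : overlay α c y γ (c + 1 + a, y + b) = some v := by
  have : 0 ≤ a := grow_supp hγ (p := (a, b)) (by simp [hv])
  simp only [overlay]
  rw [if_neg (by omega)]
  simpa using hv

lemma cross_dvd {S : TAS} (hS : StrictlySelfAssembles S UFractal) {m : ℕ} {y : ℤ} {t : TileType}
    (h : Cross S m y t) : (3:ℤ) ^ m ∣ y := by
  obtain ⟨α, hα, hc, ht, hs⟩ := h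
  have := attach_pos ((temp_pos hS).trans hs)
  simp only at this
  have : α (cc m, y) ≠ none := by
    rcases this with h | h | h | h
    · have := hc _ h
      simp only at this; omega
    · simpa using h
    · have := hc _ h
      simp only at this; omega
    · have := hc _ h
      simp only at this; omega
  exact geo_cut (finProd_sub hS hα this)

lemma cross_mem {S : TAS} (hS : StrictlySelfAssembles S UFractal) {m : ℕ} {y : ℤ} {t : TileType}
    (h : Cross S m y t) {γ : Assembly} (hγ : Grow S t γ) {a b : ℤ} (hab : γ (a, b) ≠ none) :
    (cc m + 1 + a, y + b) ∈ UFractal := by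
  obtain ⟨α, hα, hc, ht, hs⟩ := h
  obtain ⟨v, hv⟩ := Option.ne_none_iff_exists'.1 hab
  refine finProd_sub hS (embed hα hc ht hs hγ) ?_
  rw [overlay_at hγ hv]
  simp

/-! ## Heights of the growths of crossing tiles -/

/-- The part of `γ` with abscissa less than `A`. -/
def lo (A : ℤ) (γ : Assembly) : Assembly := fun p => if p.1 < A then γ p else none

/-- The part of `γ` with abscissa at least `A`, moved to the origin. -/
def hi (A : ℤ) (γ : Assembly) : Assembly := fun p => if 0 ≤ p.1 then γ (p.1 + A, p.2) else none

lemma lo_some {A : ℤ} {γ : Assembly} {p : Pt} {u : TileType} (h : lo A γ p = some u) :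
    p.1 < A ∧ γ p = some u := by
  unfold lo at h
  split_ifs at h with h1
  exact ⟨h1, h⟩

lemma lo_of {A : ℤ} {γ : Assembly} {p : Pt} (h : p.1 < A) : lo A γ p = γ p := if_pos h

lemma lo_update_lt {A : ℤ} {γ : Assembly} {p : Pt} {u : Option TileType} (h : p.1 < A) :
    lo A (Function.update γ p u) = Function.update (lo A γ) p u := by
  funext q
  by_cases hq : q = p
  · subst hq; simp [lo, h]
  · simp [lo, Function.update_of_ne hq]

lemma lo_update_ge {A : ℤ} {γ : Assembly} {p : Pt} {u : Option TileType} (h : A ≤ p.1) :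
    lo A (Function.update γ p u) = lo A γ := by
  funext q
  by_cases hq : q = p
  · subst hq; simp [lo, not_lt.2 h]
  · simp [lo, Function.update_of_ne hq]

lemma hi_update_lt {A : ℤ} {γ : Assembly} {p : Pt} {u : Option TileType} (h : p.1 < A) :
    hi A (Function.update γ p u) = hi A γ := by
  funext q
  unfold hi
  split_ifs with h0
  · rw [Function.update_of_ne]
    rintro rfl
    simp only at h; omega
  · rfl

lemma hi_update_ge {A : ℤ} {γ : Assembly} {p : Pt} {u : Option TileType} (h : A ≤ p.1) :
    hi A (Function.update γ p u) = Function.update (hi A γ) (p.1 - A, p.2) u := by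
  funext q
  by_cases hq : q = (p.1 - A, p.2)
  · subst hq; simp [hi, h]
  · rw [Function.update_of_ne hq]
    unfold hi
    split_ifs with h0
    · rw [Function.update_of_ne]
      rintro rfl
      apply hq
      simp
    · rfl

lemma update_mono {γ : Assembly} {p q : Pt} {t u : TileType} (hn : γ p = none)
    (h : γ q = some u) : Function.update γ p (some t) q = some u := by
  have : q ≠ p := by
    rintro rfl
    rw [hn] at h; simp at h
  rw [Function.update_of_ne this]; exact h

lemma cross_succ {S : TAS} {m : ℕ} {y : ℤ} {t t' : TileType} (h : Cross S m y t) {γ : Assembly}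
    (hγ : Grow S t (lo (3 ^ m) γ)) (ht' : t' ∈ S.tiles)
    (hs' : S.temp ≤ attachStrength S.strength (lo (3 ^ m) γ) (3 ^ m, 0) t') :
    Cross S (m + 1) y t' := by
  obtain ⟨α, hα, hc, ht, hs⟩ := h
  have hpos : (0:ℤ) < 3 ^ m := by positivity
  refine ⟨_, embed hα hc ht hs hγ, ?_, ht', hs'.trans (attach_mono ?_ ?_ ?_ ?_)⟩
  · intro p hp
    rw [cc]
    unfold overlay at hp
    split_ifs at hp with h1
    · omega
    · obtain ⟨u, hu⟩ := Option.ne_none_iff_exists'.1 hp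
      have := (lo_some hu).1
      simp only at this
      omega
  all_goals
    intro v hv
    have := overlay_at (α := α) (c := cc m) (y := y) hγ hv
    convert this using 2
    simp only [cc, Prod.mk.injEq]
    constructor <;> ring

lemma height_inv {S : TAS} (hS : StrictlySelfAssembles S UFractal) {m m' N : ℕ} (hm : m < m')
    (hN : N ≤ m') {t : TileType} {y y' : ℤ} (h1 : Cross S m y t) (h2 : Cross S m' y' t) (A : ℤ)
    (IH : ∀ t' y'', Cross S (m + 1) y'' t' → ∀ γ, Grow S t' γ →
      (∀ p, γ p ≠ none → p.1 < A - 3 ^ m) → ∀ p, γ p ≠ none → 0 ≤ p.2 ∧ p.2 < 3 ^ N)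
    {γ : Assembly} (hγ : Grow S t γ) (hA : ∀ p, γ p ≠ none → p.1 < A) :
    (∀ p, γ p ≠ none → p.1 < 3 ^ m → 0 ≤ p.2 ∧ p.2 < 3 ^ m) ∧ Grow S t (lo (3 ^ m) γ) ∧
    ((∀ p, γ p ≠ none → p.1 < 3 ^ m) ∨ ∃ t', t' ∈ S.tiles ∧
      S.temp ≤ attachStrength S.strength (lo (3 ^ m) γ) (3 ^ m, 0) t' ∧ γ (3 ^ m, 0) = some t' ∧
      Grow S t' (hi (3 ^ m) γ)) := by
  have hpos : (0:ℤ) < 3 ^ m := by positivity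
  have hτ := temp_pos hS
  have hy := cross_dvd hS h1
  have hy' := cross_dvd hS h2
  induction hγ with
  | base =>
    have hsupp : ∀ p, single t p ≠ none → p = (0, 0) := by
      intro p hp
      by_contra h0
      simp [single, Function.update_of_ne h0] at hp
    refine ⟨?_, ?_, Or.inl ?_⟩
    · intro p hp _
      rw [hsupp p hp]
      exact ⟨le_rfl, hpos⟩
    · have : lo (3 ^ m) (single t) = single t := by
        funext p
        unfold lo
        split_ifs with h
        · rfl
        · by_contra hc
          rw [hsupp p (Ne.symm hc)] at h
          exact h hpos
      rw [this]
      exact Gen.base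
    · intro p hp
      rw [hsupp p hp]
      exact hpos
  | @step γ p u hγ hR hu hn hst ih =>
    have hR : 0 ≤ p.1 := hR
    have hγ' : Grow S t (Function.update γ p (some u)) := Gen.step hγ hR hu hn hst
    have hup : ∀ q, γ q ≠ none → Function.update γ p (some u) q ≠ none := by
      intro q hq
      obtain ⟨v, hv⟩ := Option.ne_none_iff_exists'.1 hq
      rw [update_mono hn hv]; simp
    have hAγ : ∀ q, γ q ≠ none → q.1 < A := fun q hq => hA q (hup q hq)
    obtain ⟨i1, i2, i3⟩ := ih hAγ
    have memm : ∀ a b, γ (a, b) ≠ none → (cc m + 1 + a, y + b) ∈ UFractal :=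
      fun a b hab => cross_mem hS h1 hγ hab
    have hpm : (cc m + 1 + p.1, y + p.2) ∈ UFractal :=
      cross_mem hS h1 hγ' (a := p.1) (b := p.2) (by simp)
    have hpm' : (cc m' + 1 + p.1, y' + p.2) ∈ UFractal :=
      cross_mem hS h2 hγ' (a := p.1) (b := p.2) (by simp)
    -- the only passage
    have pass : ∀ b, γ (3 ^ m - 1, b) ≠ none → b = 0 ∧ (3:ℤ) ^ (m + 1) ∣ y := by
      intro b hb
      have hb1 := i1 _ hb (by simp)
      have hb2 := memm _ _ hb
      rw [show cc m + 1 + (3 ^ m - 1) = cc (m + 1) by rw [cc]; ring] at hb2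
      have hd := geo_cut hb2
      have hd2 : (3:ℤ) ^ m ∣ b :=
        (dvd_add_right hy).1 ((pow_dvd_pow 3 (Nat.le_succ m)).trans hd)
      have hb0 : b = 0 := Int.eq_zero_of_dvd_of_nonneg_of_lt hb1.1 hb1.2 hd2
      refine ⟨hb0, ?_⟩
      simpa [hb0] using hd
    by_cases hpA : p.1 < 3 ^ m
    · -- the new tile is on the left part
      have noret : p.1 + 1 = 3 ^ m → γ (p.1 + 1, p.2) = none := by
        intro he
        by_contra hc
        rcases i3 with i3 | ⟨t', ht', hs', -, hg'⟩
        · have := i3 _ hc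
          simp only at this; omega
        · have hcr := cross_succ h1 i2 ht' hs'
          have hleft : γ (3 ^ m - 1, 0) ≠ none := by
            have := attach_pos (hτ.trans hs')
            rcases this with h | h | h | h <;>
              obtain ⟨v, hv⟩ := Option.ne_none_iff_exists'.1 h <;>
              obtain ⟨e1, e2⟩ := lo_some hv
            · simp only at e1; omega
            · simp only at e2; simp [e2]
            · simp only at e1; omega
            · simp only at e1; omega
          have hdy := (pass 0 hleft).2
          have hh := IH t' y hcr _ hg' (by
            intro q hq
            unfold hi at hq
            split_ifs at hq with h0
            · have := hAγ _ hq
              simp only at this; omega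
            · simp at hq) (0, p.2) (by simpa [hi, he] using hc)
          have hpe : p.1 = 3 ^ m - 1 := by omega
          rw [show cc m + 1 + p.1 = cc (m + 1) by rw [cc, hpe]; ring] at hpm
          have hdb : (3:ℤ) ^ (m + 1) ∣ p.2 := (dvd_add_right hdy).1 (geo_cut hpm)
          rw [show cc m' + 1 + p.1 = cc m' + 3 ^ m by rw [hpe]; ring] at hpm'
          have hp0 : p.2 = 0 := geo_return hm hN hy' hdb hh.1 hh.2 hpm'
          apply hleft
          rw [← hpe, ← hp0]
          exact hn
      have hst' : S.temp ≤ attachStrength S.strength (lo (3 ^ m) γ) p u := by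
        refine hst.trans (attach_mono ?_ ?_ ?_ ?_)
        · intro v hv
          rw [lo_of]
          · exact hv
          · by_contra hc
            rw [noret (by simp only at hc; omega)] at hv
            simp at hv
        · intro v hv
          rw [lo_of (by simp only; omega)]; exact hv
        · intro v hv
          rw [lo_of (by simp only; omega)]; exact hv
        · intro v hv
          rw [lo_of (by simp only; omega)]; exact hv
      refine ⟨?_, ?_, ?_⟩
      · intro q hq hqA
        by_cases hqp : q = p
        · subst hqp
          rcases attach_pos (hτ.trans hst') with h | h | h | h <;>
            obtain ⟨v, hv⟩ := Option.ne_none_iff_exists'.1 h <;>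
            obtain ⟨e1, e2⟩ := lo_some hv
          · exact i1 (q.1 + 1, q.2) (by rw [e2]; simp) e1
          · exact i1 (q.1 - 1, q.2) (by rw [e2]; simp) e1
          · have hb := i1 _ (by rw [e2]; simp) e1
            exact geo_vert hm hy hy' hR hpA hb.1 hb.2 (Or.inr (by ring))
              (memm _ _ (by rw [e2]; simp)) hpm hpm'
          · have hb := i1 _ (by rw [e2]; simp) e1
            exact geo_vert hm hy hy' hR hpA hb.1 hb.2 (Or.inl (by ring))
              (memm _ _ (by rw [e2]; simp)) hpm hpm'
        · rw [Function.update_of_ne hqp] at hq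
          exact i1 q hq hqA
      · rw [lo_update_lt hpA]
        exact Gen.step i2 hR hu (by rw [lo_of hpA]; exact hn) hst'
      · rcases i3 with i3 | ⟨t', ht', hs', he', hg'⟩
        · left
          intro q hq
          by_cases hqp : q = p
          · rw [hqp]; exact hpA
          · rw [Function.update_of_ne hqp] at hq
            exact i3 q hq
        · right
          refine ⟨t', ht', ?_, update_mono hn he', ?_⟩
          · rw [lo_update_lt hpA]
            have hn' : lo (3 ^ m) γ p = none := by rw [lo_of hpA]; exact hn
            exact hs'.trans (attach_mono (fun v => update_mono hn') (fun v => update_mono hn')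
              (fun v => update_mono hn') (fun v => update_mono hn'))
          · rw [hi_update_lt hpA]; exact hg'
    · -- the new tile is on the right part
      have hpA : (3:ℤ) ^ m ≤ p.1 := not_lt.1 hpA
      rw [lo_update_ge hpA, hi_update_ge hpA]
      refine ⟨?_, i2, Or.inr ?_⟩
      · intro q hq hqA
        rw [Function.update_of_ne (by rintro rfl; omega)] at hq
        exact i1 q hq hqA
      · rcases i3 with i3 | ⟨t', ht', hs', he', hg'⟩
        · have hp0 : p = (3 ^ m, 0) := by
            rcases attach_pos (hτ.trans hst) with h | h | h | h
            · have := i3 _ h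
              simp only at this; omega
            · have hlt := i3 _ h
              simp only at hlt
              have hpe : p.1 = 3 ^ m := by omega
              rw [hpe] at h
              exact Prod.ext hpe (pass _ h).1
            · have := i3 _ h
              simp only at this; omega
            · have := i3 _ h
              simp only at this; omega
          have hlo : lo (3 ^ m) γ = γ := by
            funext q
            unfold lo
            split_ifs with h
            · rfl
            · by_contra hc
              exact h (i3 q (Ne.symm hc))
          refine ⟨u, hu, ?_, ?_, ?_⟩
          · rw [hlo, ← hp0]; exact hst
          · rw [← hp0]; simp
          · have : hi (3 ^ m) γ = fun _ => none := by
              funext q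
              unfold hi
              split_ifs with h
              · by_contra hc
                have := i3 _ hc
                simp only at this; omega
              · rfl
            rw [this, hp0, sub_self]
            exact Gen.base
        · refine ⟨t', ht', hs', update_mono hn he', ?_⟩
          refine Gen.step hg' (show 0 ≤ p.1 - 3 ^ m by omega) hu ?_
            (hst.trans (attach_mono ?_ ?_ ?_ ?_))
          · simp only [hi]
            rw [if_pos (by omega)]
            simpa using hn
          · intro v hv
            simp only [hi]
            rw [if_pos (by omega), ← hv]
            congr 2; ring
          · intro v hv
            have hne : p.1 ≠ 3 ^ m := by
              intro hpe
              rw [hpe] at hv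
              have h0 := (pass p.2 (by rw [hv]; simp)).1
              rw [show p = (3 ^ m, 0) from Prod.ext hpe h0, he'] at hn
              simp at hn
            simp only [hi]
            rw [if_pos (by omega), ← hv]
            congr 2; ring
          · intro v hv
            simp only [hi]
            rw [if_pos (by omega), ← hv]
            congr 2; ring
          · intro v hv
            simp only [hi]
            rw [if_pos (by omega), ← hv]
            congr 2; ring

lemma gen_bounded {S : TAS} {t : TileType} {γ : Assembly} (hγ : Grow S t γ) :
    ∃ A : ℕ, ∀ p, γ p ≠ none → p.1 < A := by
  induction hγ with
  | base =>
    refine ⟨1, fun p hp => ?_⟩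
    by_cases h0 : p = (0, 0)
    · rw [h0]; simp
    · simp [single, Function.update_of_ne h0] at hp
  | @step γ p u hγ hR hu hn hst ih =>
    obtain ⟨A, hA⟩ := ih
    refine ⟨A + (p.1.toNat + 1), fun q hq => ?_⟩
    by_cases hqp : q = p
    · rw [hqp]; push_cast; omega
    · rw [Function.update_of_ne hqp] at hq
      have := hA q hq
      push_cast; omega

/-- The growth of a crossing tile has bounded height. -/
lemma height_bound {S : TAS} (hS : StrictlySelfAssembles S UFractal) {M N : ℕ}
    (hM : ∀ t m, M ≤ m → (∃ y, Cross S m y t) → (∃ m1, M ≤ m1 ∧ m1 ≤ N ∧ ∃ y, Cross S m1 y t) ∧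
      ∃ m2, N < m2 ∧ ∃ y, Cross S m2 y t) (A : ℕ) :
    ∀ t m y, M ≤ m → Cross S m y t → ∀ γ, Grow S t γ → (∀ p, γ p ≠ none → p.1 < A) →
      ∀ p, γ p ≠ none → 0 ≤ p.2 ∧ p.2 < 3 ^ N := by
  induction A using Nat.strong_induction_on with
  | _ A ihA =>
    intro t m₀ y₀ hm₀ hcr γ hγ hA p hp
    obtain ⟨⟨m, hMm, hmN, y, h1⟩, m', hm', y', h2⟩ := hM t m₀ hm₀ ⟨y₀, hcr⟩
    have hpos : (0:ℤ) < 3 ^ m := by positivity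
    have IH : ∀ t' y'', Cross S (m + 1) y'' t' → ∀ γ, Grow S t' γ →
      (∀ p, γ p ≠ none → p.1 < (A:ℤ) - 3 ^ m) → ∀ p, γ p ≠ none → 0 ≤ p.2 ∧ p.2 < 3 ^ N := by
      intro t' y'' hc γ hγ hb p hp
      have h0 := hb p hp
      have h00 := grow_supp hγ hp
      refine ihA (A - 3 ^ m) ?_ t' (m + 1) y'' (by omega) hc γ hγ ?_ p hp
      · have : 0 < 3 ^ m := by positivity
        have : (0:ℤ) < A := by omega
        omega
      · intro q hq
        have := hb q hq
        have h3 : ((3 ^ m : ℕ) : ℤ) = 3 ^ m := by push_cast; rfl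
        omega
    obtain ⟨i1, i2, i3⟩ := height_inv hS (by omega) hm'.le h1 h2 A IH hγ hA
    have hle : (3:ℤ) ^ m ≤ 3 ^ N := pow_le_pow_right₀ (by norm_num) hmN
    by_cases hpA : p.1 < 3 ^ m
    · have := i1 p hp hpA
      omega
    · rcases i3 with i3 | ⟨t', ht', hs', he', hg'⟩
      · exact absurd (i3 p hp) hpA
      · refine IH t' y (cross_succ h1 i2 ht' hs') _ hg' ?_ (p.1 - 3 ^ m, p.2) ?_
        · intro q hq
          unfold hi at hq
          split_ifs at hq with h0
          · have := hA _ hq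
            simp only at this; omega
          · simp at hq
        · simp only [hi]
          rw [if_pos (by omega)]
          simpa using hp

/-! ## Decomposition of the producible assemblies at a cut -/

/-- The part of `α` on the right of the cut `c`, with heights in `[y, y + h)`, moved to the
origin. -/
def slice (h c y : ℤ) (α : Assembly) : Assembly := fun q =>
  if 0 ≤ q.1 ∧ 0 ≤ q.2 ∧ q.2 < h then α (q.1 + (c + 1), q.2 + y) else none

lemma slice_update_out {h c y : ℤ} {α : Assembly} {p : Pt} {u : Option TileType}
    (hp : p.1 ≤ c ∨ p.2 < y ∨ y + h ≤ p.2) :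
    slice h c y (Function.update α p u) = slice h c y α := by
  funext q
  unfold slice
  split_ifs with h0
  · rw [Function.update_of_ne]
    rintro rfl
    simp only at hp; omega
  · rfl

lemma slice_update_in {h c y : ℤ} {α : Assembly} {p : Pt} {u : Option TileType}
    (h1 : c < p.1) (h2 : y ≤ p.2) (h3 : p.2 < y + h) :
    slice h c y (Function.update α p u) =
      Function.update (slice h c y α) (p.1 - (c + 1), p.2 - y) u := by
  funext q
  by_cases hq : q = (p.1 - (c + 1), p.2 - y)
  · subst hq
    simp only [slice, Function.update_self]
    rw [if_pos (by omega)]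
    simp
  · rw [Function.update_of_ne hq]
    unfold slice
    split_ifs with h0
    · rw [Function.update_of_ne]
      rintro rfl
      apply hq
      simp
    · rfl

lemma eq_of_dvd_close {d y y' : ℤ} (h : d ∣ y) (h' : d ∣ y') (h1 : y - y' < d) (h2 : y' - y < d) :
    y = y' := by
  have hd : d ∣ y - y' := dvd_sub h h'
  have := Int.eq_zero_of_abs_lt_dvd hd (by rw [abs_lt]; omega)
  omega

lemma decompose {S : TAS} (hS : StrictlySelfAssembles S UFractal) {m N : ℕ} (hNm : N + 1 ≤ m)
    (hseed : ∀ p, S.seed p ≠ none → p.1 ≤ cc m)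
    (hgrow : ∀ t y, Cross S m y t → ∀ γ, Grow S t γ → ∀ p, γ p ≠ none → 0 ≤ p.2 ∧ p.2 < 3 ^ N)
    {α : Assembly} (hα : FinProd S α) :
    FinProd S (lo (cc m + 1) α) ∧ ∀ p, α p ≠ none → cc m < p.1 → ∃ y t, t ∈ S.tiles ∧
      (3:ℤ) ^ m ∣ y ∧ S.temp ≤ attachStrength S.strength (lo (cc m + 1) α) (cc m + 1, y) t ∧
      α (cc m + 1, y) = some t ∧ Grow S t (slice (3 ^ N) (cc m) y α) ∧ y ≤ p.2 ∧
      p.2 < y + 3 ^ N := by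
  have hτ := temp_pos hS
  have hpos : (0:ℤ) < 3 ^ N := by positivity
  have hgap : (3:ℤ) ^ N * 3 ≤ 3 ^ m := by
    rw [← pow_succ]; exact pow_le_pow_right₀ (by norm_num) hNm
  have locross : ∀ α : Assembly, FinProd S (lo (cc m + 1) α) → ∀ y t, t ∈ S.tiles →
      S.temp ≤ attachStrength S.strength (lo (cc m + 1) α) (cc m + 1, y) t → Cross S m y t := by
    intro α h y t ht hs
    refine ⟨_, h, ?_, ht, hs⟩
    intro p hp
    obtain ⟨v, hv⟩ := Option.ne_none_iff_exists'.1 hp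
    have := (lo_some hv).1
    omega
  induction hα with
  | base =>
    have : lo (cc m + 1) S.seed = S.seed := by
      funext q
      unfold lo
      split_ifs with h
      · rfl
      · by_contra hc
        have := hseed q (Ne.symm hc)
        omega
    rw [this]
    refine ⟨Gen.base, ?_⟩
    intro p hp hp2
    have := hseed p hp
    omega
  | @step α p u hα hR hu hn hst ih =>
    obtain ⟨i2, i3⟩ := ih
    have hα' : FinProd S (Function.update α p (some u)) := Gen.step hα hR hu hn hst
    have hpU : p ∈ UFractal := finProd_sub hS hα' (by simp)
    by_cases hpc : p.1 ≤ cc m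
    · -- new tile on the left
      have hpA : p.1 < cc m + 1 := by omega
      have hn' : lo (cc m + 1) α p = none := by rw [lo_of hpA]; exact hn
      have noret : p.1 = cc m → α (p.1 + 1, p.2) = none := by
        intro he
        by_contra hc
        obtain ⟨y, t, ht, hd, hs, -, -, e1, e2⟩ := i3 _ hc (by simp only; omega)
        simp only at e1 e2
        have hd2 : (3:ℤ) ^ m ∣ p.2 := by
          apply geo_cut
          rw [← he]; exact hpU
        have hyp : p.2 = y := eq_of_dvd_close hd2 hd (by omega) (by omega)
        have hleft : α (cc m, y) ≠ none := by
          rcases attach_pos (hτ.trans hs) with h | h | h | h <;>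
            obtain ⟨v, hv⟩ := Option.ne_none_iff_exists'.1 h <;>
            obtain ⟨e1, e2⟩ := lo_some hv
          · simp only at e1; omega
          · simp only [add_sub_cancel_right] at e2; simp [e2]
          · simp only at e1; omega
          · simp only at e1; omega
        apply hleft
        rw [← he, ← hyp]
        exact hn
      rw [lo_update_lt hpA]
      refine ⟨Gen.step i2 hR hu hn' (hst.trans (attach_mono ?_ ?_ ?_ ?_)), ?_⟩
      · intro v hv
        rw [lo_of]
        · exact hv
        · by_contra hc
          rw [noret (by simp only at hc; omega)] at hv
          simp at hv
      · intro v hv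
        rw [lo_of (by simp only; omega)]; exact hv
      · intro v hv
        rw [lo_of (by simp only; omega)]; exact hv
      · intro v hv
        rw [lo_of (by simp only; omega)]; exact hv
      · intro q hq hqc
        rw [Function.update_of_ne (by rintro rfl; omega)] at hq
        obtain ⟨y, t, ht, hd, hs, he, hg, e1, e2⟩ := i3 q hq hqc
        refine ⟨y, t, ht, hd, ?_, update_mono hn he, ?_, e1, e2⟩
        · exact hs.trans (attach_mono (fun v => update_mono hn') (fun v => update_mono hn')
              (fun v => update_mono hn') (fun v => update_mono hn'))
        · rw [slice_update_out (Or.inl hpc)]; exact hg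
    · -- new tile on the right
      have hpc : cc m < p.1 := not_le.1 hpc
      rw [lo_update_ge (by omega)]
      refine ⟨i2, ?_⟩
      by_cases hcr : p.1 = cc m + 1 ∧ α (cc m, p.2) ≠ none
      · -- a new crossing
        obtain ⟨hpe, hleft⟩ := hcr
        have hd : (3:ℤ) ^ m ∣ p.2 := geo_cut (finProd_sub hS hα hleft)
        have hpp : p = (cc m + 1, p.2) := Prod.ext hpe rfl
        have far : ∀ q : Pt, α q ≠ none → cc m < q.1 → p.2 - 1 ≤ q.2 → q.2 ≤ p.2 + 3 ^ N →
            False := by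
          intro q hq hqc hq1 hq2
          obtain ⟨y, t, ht, hdy, hs, he, hg, e1, e2⟩ := i3 q hq hqc
          have : p.2 = y := eq_of_dvd_close hd hdy (by omega) (by omega)
          rw [← this, ← hpp, hn] at he
          simp at he
        have hst' : S.temp ≤ attachStrength S.strength (lo (cc m + 1) α) (cc m + 1, p.2) u := by
          rw [← hpp]
          refine hst.trans (attach_mono ?_ ?_ ?_ ?_)
          · intro v hv
            exact (far _ (by rw [hv]; simp) (by simp only; omega) (by simp only; omega)
              (by simp only; omega)).elim
          · intro v hv
            rw [lo_of (by simp only; omega)]; exact hv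
          · intro v hv
            exact (far _ (by rw [hv]; simp) (by simp only; omega) (by simp only; omega)
              (by simp only; omega)).elim
          · intro v hv
            exact (far _ (by rw [hv]; simp) (by simp only; omega) (by simp only; omega)
              (by simp only; omega)).elim
        intro q hq hqc
        by_cases hqp : q = p
        · subst hqp
          refine ⟨q.2, u, hu, hd, hst', ?_, ?_, le_rfl, by omega⟩
          · rw [← hpp]; simp
          · rw [slice_update_in hqc le_rfl (by omega), hpe, sub_self, sub_self]
            have : slice (3 ^ N) (cc m) q.2 α = fun _ => none := by
              funext r
              unfold slice
              split_ifs with h0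
              · by_contra hc
                exact far _ hc (by simp only; omega) (by simp only; omega) (by simp only; omega)
              · rfl
            rw [this]
            exact Gen.base
        · rw [Function.update_of_ne hqp] at hq
          obtain ⟨y, t, ht, hdy, hs, he, hg, e1, e2⟩ := i3 q hq hqc
          refine ⟨y, t, ht, hdy, hs, update_mono hn he, ?_, e1, e2⟩
          rw [slice_update_out]
          · exact hg
          · right
            by_contra hc
            have : p.2 = y := eq_of_dvd_close hd hdy (by omega) (by omega)
            rw [← this, ← hpp, hn] at he
            simp at he
      · -- growth inside a slice
        have hnl : ∀ v, α (p.1 - 1, p.2) = some v → cc m < p.1 - 1 := by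
          intro v hv
          by_contra hc
          have hpe : p.1 = cc m + 1 := by omega
          apply hcr
          refine ⟨hpe, ?_⟩
          rw [hpe, add_sub_cancel_right] at hv
          rw [hv]; simp
        obtain ⟨q0, hq0, hq0c, hq01, hq02⟩ : ∃ q0, α q0 ≠ none ∧ cc m < q0.1 ∧ p.2 - 1 ≤ q0.2 ∧
            q0.2 ≤ p.2 + 1 := by
          rcases attach_pos (hτ.trans hst) with h | h | h | h
          · exact ⟨_, h, by simp only; omega, by simp only; omega, by simp only; omega⟩
          · obtain ⟨v, hv⟩ := Option.ne_none_iff_exists'.1 h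
            exact ⟨_, h, hnl v hv, by simp only; omega, by simp only; omega⟩
          · exact ⟨_, h, by simp only; omega, by simp only; omega, by simp only; omega⟩
          · exact ⟨_, h, by simp only; omega, by simp only; omega, by simp only; omega⟩
        obtain ⟨y, t, ht, hdy, hs, he, hg, e1, e2⟩ := i3 q0 hq0 hq0c
        have near : ∀ a b v, α (a, b) = some v → cc m < a → p.2 - 1 ≤ b → b ≤ p.2 + 1 →
            ∀ a' b', a' = a - (cc m + 1) → b' = b - y →
            slice (3 ^ N) (cc m) y α (a', b') = some v := by
          rintro a b v hv ha hb1 hb2 a' b' rfl rfl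
          obtain ⟨y2, t2, ht2, hdy2, hs2, he2, hg2, f1, f2⟩ :=
            i3 (a, b) (by rw [hv]; simp) ha
          simp only at f1 f2
          have : y = y2 := eq_of_dvd_close hdy hdy2 (by omega) (by omega)
          subst this
          simp only [slice]
          rw [if_pos (by omega)]
          simpa using hv
        have hg' : Grow S t (Function.update (slice (3 ^ N) (cc m) y α)
            (p.1 - (cc m + 1), p.2 - y) (some u)) := by
          refine Gen.step hg (show 0 ≤ p.1 - (cc m + 1) by omega) hu ?_
            (hst.trans (attach_mono ?_ ?_ ?_ ?_))
          · simp only [slice]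
            split_ifs
            · simpa using hn
            · rfl
          · intro v hv
            exact near _ _ v hv (by omega) (by omega) (by omega) _ _ (by ring) (by ring)
          · intro v hv
            exact near _ _ v hv (hnl v hv) (by omega) (by omega) _ _ (by ring) (by ring)
          · intro v hv
            exact near _ _ v hv (by omega) (by omega) (by omega) _ _ (by ring) (by ring)
          · intro v hv
            exact near _ _ v hv (by omega) (by omega) (by omega) _ _ (by ring) (by ring)
        have hh := hgrow t y (locross α i2 y t ht hs) _ hg' (p.1 - (cc m + 1), p.2 - y) (by simp)
        simp only at hh
        intro q hq hqc
        by_cases hqp : q = p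
        · subst hqp
          refine ⟨y, t, ht, hdy, hs, update_mono hn he, ?_, by omega, by omega⟩
          rw [slice_update_in hqc (by omega) (by omega)]
          exact hg'
        · rw [Function.update_of_ne hqp] at hq
          obtain ⟨y2, t2, ht2, hdy2, hs2, he2, hg2, f1, f2⟩ := i3 q hq hqc
          refine ⟨y2, t2, ht2, hdy2, hs2, update_mono hn he2, ?_, f1, f2⟩
          by_cases hyy : y = y2
          · subst hyy
            have : t = t2 := by
              rw [he] at he2; simpa using he2
            subst this
            rw [slice_update_in hpc (by omega) (by omega)]
            exact hg'
          · rw [slice_update_out]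
            · exact hg2
            · right
              by_contra hc
              exact hyy (eq_of_dvd_close hdy hdy2 (by omega) (by omega))

/-! ## Choice of the scales -/

lemma scales (T : Finset TileType) (P : ℕ → TileType → Prop) (hP : ∀ m t, P m t → t ∈ T) :
    ∃ M N, ∀ t m, M ≤ m → P m t → (∃ m1, M ≤ m1 ∧ m1 ≤ N ∧ P m1 t) ∧ ∃ m2, N < m2 ∧ P m2 t := by
  have h1 : ∃ M, ∀ t ∈ T, ∀ m, M ≤ m → P m t → ∀ K, ∃ m2, K < m2 ∧ P m2 t := by
    have : ∀ᶠ M in Filter.atTop, ∀ t ∈ T, ∀ m, M ≤ m → P m t → ∀ K, ∃ m2, K < m2 ∧ P m2 t := by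
      rw [Filter.eventually_all_finset]
      intro t _
      by_cases h : ∀ K, ∃ m2, K < m2 ∧ P m2 t
      · exact Filter.Eventually.of_forall fun M m _ _ => h
      · push Not at h
        obtain ⟨K, hK⟩ := h
        filter_upwards [Filter.eventually_gt_atTop K] with M hM m hm hPm
        exact absurd hPm (hK m (by omega))
    exact this.exists
  obtain ⟨M, hM⟩ := h1
  have h2 : ∃ N, ∀ t ∈ T, ∀ m, M ≤ m → P m t → ∃ m1, M ≤ m1 ∧ m1 ≤ N ∧ P m1 t := by
    have : ∀ᶠ N in Filter.atTop, ∀ t ∈ T, ∀ m, M ≤ m → P m t →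
        ∃ m1, M ≤ m1 ∧ m1 ≤ N ∧ P m1 t := by
      rw [Filter.eventually_all_finset]
      intro t _
      by_cases h : ∃ m, M ≤ m ∧ P m t
      · obtain ⟨m1, h1, h2⟩ := h
        filter_upwards [Filter.eventually_ge_atTop m1] with N hN m _ _
        exact ⟨m1, h1, hN, h2⟩
      · exact Filter.Eventually.of_forall fun N m h1 h2 => absurd ⟨m, h1, h2⟩ h
    exact this.exists
  obtain ⟨N, hN⟩ := h2
  exact ⟨M, N, fun t m hm hp => ⟨hN t (hP m t hp) m hm hp, hM t (hP m t hp) m hm hp N⟩⟩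

lemma le_cc (n : ℕ) : (n : ℤ) ≤ cc n := by
  induction n with
  | zero => simp [cc]
  | succ n ih =>
    have : (0:ℤ) < 3 ^ n := by positivity
    rw [cc]; push_cast; omega

/-- No aTAM tile assembly system strictly self-assembles the
U fractal `𝐔`. -/
theorem uFractal_not_strictlySelfAssembles :
    ∀ S : TAS, ¬ StrictlySelfAssembles S UFractal := by
  intro S hS
  obtain ⟨M, N, hMN⟩ := scales S.tiles (fun m t => ∃ y, Cross S m y t)
    (fun m t ⟨y, α, h⟩ => h.2.2.1)
  obtain ⟨X, hX⟩ : ∃ X : ℕ, ∀ p, S.seed p ≠ none → p.1 ≤ X := by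
    obtain ⟨B, hB⟩ := (S.seed_finite.image Prod.fst).bddAbove
    refine ⟨B.toNat, fun p hp => ?_⟩
    have : p.1 ≤ B := hB ⟨p, hp, rfl⟩
    omega
  -- the scale at which we look
  obtain ⟨n, hn⟩ : ∃ n, n = M + N + X := ⟨_, rfl⟩
  obtain ⟨α, hα, hp⟩ := finProd_hits hS (p := (3 ^ (n + 1) - 1, 3 ^ (n + 1) - 1))
    ⟨n + 1, by omega, corner_mem n⟩
  have hdec := decompose hS (m := n + 1) (N := N) (by omega) (fun p hp => by
      have h1 := hX p hp
      have h2 := le_cc (n + 1)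
      push_cast at h2
      omega) (fun t y hc γ hγ p hp => by
      obtain ⟨A, hA⟩ := gen_bounded hγ
      exact height_bound hS hMN A t (n + 1) y (by omega) hc γ hγ hA p hp) hα
  have h2 := cc_two (n + 1)
  have hle : (3:ℤ) ^ (N + 1) ≤ 3 ^ (n + 1) := pow_le_pow_right₀ (by norm_num) (by omega)
  rw [pow_succ] at hle
  have hpos : (0:ℤ) < 3 ^ N := by positivity
  obtain ⟨y, t, -, hd, -, -, -, e1, e2⟩ := hdec.2 _ hp (by simp only; omega)
  simp only at e1 e2
  have hy : y = 0 := eq_of_dvd_close hd (dvd_zero _) (by omega) (by omega)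
  omega
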